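/- Let n ≥ 1 and d ≥ 1 be integers, let f be a real polynomial in n variables of total degree at most d, and let f_min denote the minimum of f over [−1,1]^n. Let r be an integer with r ≥ 3d√n + 1. Let μ_n denote the product Chebyshev probability measure on [−1,1]^n, i.e. the measure with density ∏_{i=1}^n 1/(π·√(1−y_i²)) with respect to Lebesgue measure on [−1,1]^n. Then there exists a real polynomial σ in n variables that is a finite sum of squares of real polynomials, with total degree at most 2rn, such that ∫_{[−1,1]^n} σ dμ_n = 1 and ∫_{[−1,1]^n} f·σ dμ_n − f_min ≤ 9·e·n·d²·‖f‖_{1,cheb} / (r(r−1)), where e is Euler's number. -/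

import Mathlib

open Polynomial MeasureTheory

/-- The k-th Chebyshev polynomial of the first kind over ℝ. -/
noncomputable def chebT (k : ℕ) : Polynomial ℝ := Polynomial.Chebyshev.T ℝ (k : ℤ)

/-- The Chebyshev probability measure on `[-1,1]`, `dμ(y) = dy/(π √(1-y²))`. -/
noncomputable def chebMeasure : Measure ℝ :=
  (volume.restrict (Set.Icc (-1 : ℝ) 1)).withDensity
    (fun y => ENNReal.ofReal (1 / (Real.pi * Real.sqrt (1 - y ^ 2))))

/-- The product Chebyshev probability measure on `[-1,1]^n`. -/
noncomputable def chebMeasurePi (n : ℕ) : Measure (Fin n → ℝ) :=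
  Measure.pi fun _ => chebMeasure

/-- The multivariate (tensor) Chebyshev polynomial `T_α(x) = ∏ᵢ T_{αᵢ}(xᵢ)`. -/
noncomputable def mvChebT (n : ℕ) (α : Fin n → ℕ) : MvPolynomial (Fin n) ℝ :=
  ∏ i, Polynomial.aeval (MvPolynomial.X i) (chebT (α i))

/-- The Chebyshev 1-norm of an n-variate real polynomial: the sum of the absolute values
of the coefficients in the (unique) expansion in the tensor Chebyshev basis. -/
noncomputable def mvCheb1Norm {n : ℕ} (p : MvPolynomial (Fin n) ℝ) : ℝ :=
  sInf {s : ℝ | ∃ c : (Fin n → ℕ) →₀ ℝ,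
    p = c.sum (fun α coef => MvPolynomial.C coef * mvChebT n α) ∧
    s = c.sum (fun _ coef => |coef|)}

/-- An n-variate real polynomial is a sum of squares if it is a finite sum of squares
of real polynomials. -/
def IsSOS {n : ℕ} (p : MvPolynomial (Fin n) ℝ) : Prop :=
  ∃ (s : ℕ) (h : Fin s → MvPolynomial (Fin n) ℝ), p = ∑ i, (h i) ^ 2

/-- The (unnormalised) Fejér kernel. -/
noncomputable def fejerKernel (N : ℕ) (s : ℝ) : ℝ :=
  ∑ i ∈ Finset.range N, ∑ j ∈ Finset.range N, Real.cos (((i - j : ℤ) : ℝ) * s)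

lemma fejerKernel_eq_sq_add_sq (N : ℕ) (s : ℝ) :
    fejerKernel N s = (∑ i ∈ Finset.range N, Real.cos (i * s)) ^ 2 +
      (∑ i ∈ Finset.range N, Real.sin (i * s)) ^ 2 := by
  simp only [fejerKernel, sq, Finset.sum_mul_sum, ← Finset.sum_add_distrib]
  refine Finset.sum_congr rfl fun i _ => Finset.sum_congr rfl fun j _ => ?_
  push_cast
  rw [sub_mul, Real.cos_sub]

lemma fejerKernel_mul_one_sub_cos (N : ℕ) (s : ℝ) :
    fejerKernel N s * (1 - Real.cos s) = 1 - Real.cos (N * s) := by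
  have hsum : (∑ i ∈ Finset.range N, Real.cos (i * s)) * (1 - Real.cos s) +
        (∑ i ∈ Finset.range N, Real.sin (i * s)) * Real.sin s = 1 - Real.cos (N * s) ∧
      (∑ i ∈ Finset.range N, Real.sin (i * s)) * (1 - Real.cos s) -
        (∑ i ∈ Finset.range N, Real.cos (i * s)) * Real.sin s = -Real.sin (N * s) := by
    induction N with
    | zero => simp
    | succ N ih =>
      have hN : ((N + 1 : ℕ) : ℝ) * s = N * s + s := by push_cast; ring
      rw [Finset.sum_range_succ, Finset.sum_range_succ, hN, Real.cos_add, Real.sin_add]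
      constructor <;> linarith [ih.1, ih.2]
  rw [fejerKernel_eq_sq_add_sq]
  set A := ∑ i ∈ Finset.range N, Real.cos (i * s)
  set B := ∑ i ∈ Finset.range N, Real.sin (i * s)
  obtain ⟨h₁, h₂⟩ := hsum
  have h₃ := Real.sin_sq_add_cos_sq s
  have h₄ := Real.sin_sq_add_cos_sq (N * s)
  have key : (A ^ 2 + B ^ 2) * ((1 - Real.cos s) ^ 2 + Real.sin s ^ 2) =
      (1 - Real.cos (N * s)) ^ 2 + (-Real.sin (N * s)) ^ 2 := by
    rw [← h₁, ← h₂]; ring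
  have e₁ : (1 - Real.cos s) ^ 2 + Real.sin s ^ 2 = 2 * (1 - Real.cos s) := by linarith
  have e₂ : (1 - Real.cos (N * s)) ^ 2 + (-Real.sin (N * s)) ^ 2 =
    2 * (1 - Real.cos (N * s)) := by linarith
  rw [e₁, e₂] at key
  linarith

@[fun_prop]
lemma continuous_fejerKernel (N : ℕ) : Continuous (fejerKernel N) := by
  unfold fejerKernel
  fun_prop

lemma fejerKernel_nonneg (N : ℕ) (s : ℝ) : 0 ≤ fejerKernel N s := by
  rw [fejerKernel_eq_sq_add_sq]; positivity

lemma cos_int_mul_periodic (m : ℤ) :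
    Function.Periodic (fun s : ℝ => Real.cos (m * s)) (2 * Real.pi) := fun s => by
  simp only [mul_add]
  exact Real.cos_add_int_mul_two_pi _ _

lemma fejerKernel_periodic (N : ℕ) : Function.Periodic (fejerKernel N) (2 * Real.pi) := fun s =>
  Finset.sum_congr rfl fun _ _ => Finset.sum_congr rfl fun _ _ => cos_int_mul_periodic _ s

lemma integral_cos_int_mul (m : ℤ) :
    ∫ s in -Real.pi..Real.pi, Real.cos (m * s) = if m = 0 then 2 * Real.pi else 0 := by
  split_ifs with h
  · simp [h]; ring
  · have hm : (m : ℝ) ≠ 0 := by exact_mod_cast h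
    rw [intervalIntegral.integral_comp_mul_left _ hm, integral_cos]
    simp

lemma integral_cos_int_mul_mul_one_sub_cos {m N : ℤ} (h : |m| < N) :
    ∫ s in -Real.pi..Real.pi, Real.cos (m * s) * (1 - Real.cos (N * s)) =
      if m = 0 then 2 * Real.pi else 0 := by
  have e : ∀ s : ℝ, Real.cos (m * s) * (1 - Real.cos (N * s)) = Real.cos (m * s) -
      (Real.cos ((m + N : ℤ) * s) / 2 + Real.cos ((m - N : ℤ) * s) / 2) := fun s => by
    push_cast
    rw [add_mul, sub_mul, Real.cos_add, Real.cos_sub]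
    ring
  have h₁ : m + N ≠ 0 := by have := abs_lt.mp h; lia
  have h₂ : m - N ≠ 0 := by have := abs_lt.mp h; lia
  simp only [e]
  rw [intervalIntegral.integral_sub (Continuous.intervalIntegrable (by fun_prop) _ _)
      (Continuous.intervalIntegrable (by fun_prop) _ _),
    intervalIntegral.integral_add (Continuous.intervalIntegrable (by fun_prop) _ _)
      (Continuous.intervalIntegrable (by fun_prop) _ _),
    intervalIntegral.integral_div, intervalIntegral.integral_div, integral_cos_int_mul,
    integral_cos_int_mul, integral_cos_int_mul, if_neg h₁, if_neg h₂]
  simp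

lemma integral_fejerKernel_mul_one_sub_cos (N : ℕ) :
    ∫ s in -Real.pi..Real.pi, fejerKernel N s * (1 - Real.cos (N * s)) = 2 * Real.pi * N := by
  simp only [fejerKernel, Finset.sum_mul]
  rw [intervalIntegral.integral_finsetSum
    fun i _ => Continuous.intervalIntegrable (by fun_prop) _ _]
  have : ∀ i ∈ Finset.range N, ∫ s in -Real.pi..Real.pi, ∑ j ∈ Finset.range N,
      Real.cos (((i - j : ℤ) : ℝ) * s) * (1 - Real.cos (N * s)) = 2 * Real.pi := fun i hi => by
    rw [intervalIntegral.integral_finsetSum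
      fun i _ => Continuous.intervalIntegrable (by fun_prop) _ _]
    rw [Finset.sum_congr rfl fun j hj => by
      rw [← Int.cast_natCast N, integral_cos_int_mul_mul_one_sub_cos (by
        have := Finset.mem_range.mp hi
        have := Finset.mem_range.mp hj
        rw [abs_lt]; lia)]]
    simp only [sub_eq_zero, Nat.cast_inj, Finset.sum_ite_eq, hi, if_true]
  rw [Finset.sum_congr rfl this]
  simp [mul_comm]

lemma abs_sin_nat_mul_le_mul_abs_sin (k : ℕ) (x : ℝ) :
    |Real.sin (k * x)| ≤ k * |Real.sin x| := by
  induction k with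
  | zero => simp
  | succ k ih =>
    have hk : ((k + 1 : ℕ) : ℝ) * x = k * x + x := by push_cast; ring
    rw [hk, Real.sin_add]
    refine (abs_add_le _ _).trans ?_
    rw [abs_mul, abs_mul]
    push_cast
    nlinarith [abs_nonneg (Real.sin (k * x)), abs_nonneg (Real.sin x), Real.abs_cos_le_one x,
      Real.abs_cos_le_one (k * x)]

lemma one_sub_cos_eq_two_mul_sin_half_sq (x : ℝ) :
    1 - Real.cos x = 2 * Real.sin (x / 2) ^ 2 := by
  rw [Real.sin_sq_eq_half_sub]
  ring_nf

lemma one_sub_cos_nat_mul_le (k : ℕ) (x : ℝ) :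
    1 - Real.cos (k * x) ≤ k ^ 2 * (1 - Real.cos x) := by
  rw [one_sub_cos_eq_two_mul_sin_half_sq, one_sub_cos_eq_two_mul_sin_half_sq]
  have h := abs_sin_nat_mul_le_mul_abs_sin k (x / 2)
  rw [← mul_div_assoc] at h
  have h₂ := pow_le_pow_left₀ (abs_nonneg _) h 2
  rw [mul_pow, sq_abs, sq_abs] at h₂
  linarith

lemma integral_fejerKernel_sq_mul_one_sub_cos_le (N k : ℕ) :
    ∫ s in -Real.pi..Real.pi, fejerKernel N s ^ 2 * (1 - Real.cos (k * s)) ≤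
      2 * Real.pi * N * k ^ 2 := by
  calc _ ≤ ∫ s in -Real.pi..Real.pi,
        fejerKernel N s * (1 - Real.cos (N * s)) * (k : ℝ) ^ 2 := by
        refine intervalIntegral.integral_mono_on (by linarith [Real.pi_pos])
          (Continuous.intervalIntegrable (by fun_prop) _ _)
          (Continuous.intervalIntegrable (by fun_prop) _ _) fun s _ => ?_
        rw [← fejerKernel_mul_one_sub_cos N s]
        have := mul_le_mul_of_nonneg_left (one_sub_cos_nat_mul_le k s)
          (sq_nonneg (fejerKernel N s))
        linarith
    _ = _ := by
        rw [intervalIntegral.integral_mul_const, integral_fejerKernel_mul_one_sub_cos]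

lemma le_integral_fejerKernel_sq {N : ℕ} (hN : 1 ≤ N) :
    4 / 5 * (N : ℝ) ^ 3 ≤ ∫ s in -Real.pi..Real.pi, fejerKernel N s ^ 2 := by
  have hN' : (1 : ℝ) ≤ N := by exact_mod_cast hN
  have hN0 : (0 : ℝ) < N := by linarith
  have hc : 3 / (5 * N : ℝ) ≤ 3 / 5 := by
    rw [div_le_div_iff₀ (by positivity) (by positivity)]; linarith
  have hpos : 0 < 3 / (5 * N : ℝ) := by positivity
  have hpi := Real.pi_gt_three
  have hlow : ∀ s ∈ Set.Icc (-(3 / (5 * N : ℝ))) (3 / (5 * N)),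
      41 / 50 * (N : ℝ) ^ 2 ≤ fejerKernel N s := fun s hs => by
    have : ∀ i ∈ Finset.range N, ∀ j ∈ Finset.range N,
        (41 / 50 : ℝ) ≤ Real.cos (((i - j : ℤ) : ℝ) * s) := fun i hi j hj => by
      have hi := Finset.mem_range.mp hi
      have hj := Finset.mem_range.mp hj
      have h₁ : |((i - j : ℤ) : ℝ)| ≤ N := by
        rw [← Int.cast_abs, ← Int.cast_natCast N, Int.cast_le, abs_le]; lia
      have h₂ : |((i - j : ℤ) : ℝ) * s| ≤ 3 / 5 := by
        rw [abs_mul]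
        calc _ ≤ (N : ℝ) * (3 / (5 * N)) :=
              mul_le_mul h₁ (abs_le.mpr hs) (abs_nonneg _) hN0.le
          _ = 3 / 5 := by field_simp
      have h₃ := Real.one_sub_sq_div_two_le_cos (x := ((i - j : ℤ) : ℝ) * s)
      have h₄ := pow_le_pow_left₀ (abs_nonneg _) h₂ 2
      rw [sq_abs] at h₄
      linarith
    calc 41 / 50 * (N : ℝ) ^ 2 = ∑ i ∈ Finset.range N, ∑ j ∈ Finset.range N, (41 / 50 : ℝ) := by
          simp; ring
      _ ≤ _ := Finset.sum_le_sum fun i hi => Finset.sum_le_sum fun j hj => this i hi j hj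
  calc 4 / 5 * (N : ℝ) ^ 3
      ≤ ∫ _ in -(3 / (5 * N : ℝ))..(3 / (5 * N)), (41 / 50 * (N : ℝ) ^ 2) ^ 2 := by
        rw [intervalIntegral.integral_const, smul_eq_mul]
        have : (3 / (5 * N : ℝ) - -(3 / (5 * N))) * (41 / 50 * (N : ℝ) ^ 2) ^ 2 =
          6 / 5 * (41 / 50) ^ 2 * (N : ℝ) ^ 3 := by field_simp; norm_num
        rw [this]
        gcongr
        norm_num
    _ ≤ ∫ s in -(3 / (5 * N : ℝ))..(3 / (5 * N)), fejerKernel N s ^ 2 := by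
        refine intervalIntegral.integral_mono_on (by linarith)
          (Continuous.intervalIntegrable (by fun_prop) _ _)
          (Continuous.intervalIntegrable (by fun_prop) _ _) fun s hs => ?_
        exact pow_le_pow_left₀ (by positivity) (hlow s hs) 2
    _ ≤ _ := by
        refine intervalIntegral.integral_mono_interval (by linarith) (by linarith) (by linarith)
          (Filter.Eventually.of_forall fun s => sq_nonneg _)
          (Continuous.intervalIntegrable (by fun_prop) _ _)

lemma integral_comp_add_of_periodic_two_pi {F : ℝ → ℝ} (hF : Function.Periodic F (2 * Real.pi))
    (c : ℝ) : ∫ t in -Real.pi..Real.pi, F (t + c) = ∫ t in -Real.pi..Real.pi, F t := by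
  rw [intervalIntegral.integral_comp_add_right]
  have h := hF.intervalIntegral_add_eq (-Real.pi + c) (-Real.pi)
  convert h using 2 <;> ring

lemma le_integral_fejerKernel_add_sq {N : ℕ} (hN : 1 ≤ N) (θ : ℝ) :
    8 / 5 * (N : ℝ) ^ 3 ≤ ∫ t in -Real.pi..Real.pi,
      (fejerKernel N (t - θ) + fejerKernel N (t + θ)) ^ 2 := by
  have hper : Function.Periodic (fun s => fejerKernel N s ^ 2) (2 * Real.pi) := fun s => by
    simp only [fejerKernel_periodic N s]
  have h₁ := integral_comp_add_of_periodic_two_pi hper (-θ)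
  have h₂ := integral_comp_add_of_periodic_two_pi hper θ
  simp only [← sub_eq_add_neg] at h₁
  have h₃ := le_integral_fejerKernel_sq hN
  calc 8 / 5 * (N : ℝ) ^ 3 ≤ ∫ t in -Real.pi..Real.pi,
        (fejerKernel N (t - θ) ^ 2 + fejerKernel N (t + θ) ^ 2) := by
        rw [intervalIntegral.integral_add (Continuous.intervalIntegrable (by fun_prop) _ _)
          (Continuous.intervalIntegrable (by fun_prop) _ _), h₁, h₂]
        linarith
    _ ≤ _ := by
        refine intervalIntegral.integral_mono_on (by linarith [Real.pi_pos])
          (Continuous.intervalIntegrable (by fun_prop) _ _)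
          (Continuous.intervalIntegrable (by fun_prop) _ _) fun t _ => ?_
        nlinarith [mul_nonneg (fejerKernel_nonneg N (t - θ)) (fejerKernel_nonneg N (t + θ))]

lemma abs_two_mul_mul_cos_sub_cos_le (a b u v : ℝ) :
    |2 * a * b * (Real.cos ((u + v) / 2) - Real.cos ((v - u) / 2))| ≤
      a ^ 2 * (1 - Real.cos u) + b ^ 2 * (1 - Real.cos v) := by
  have h : Real.cos ((u + v) / 2) - Real.cos ((v - u) / 2) =
      -2 * (Real.sin (u / 2) * Real.sin (v / 2)) := by
    rw [add_div, sub_div, Real.cos_add, Real.cos_sub]; ring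
  rw [h, one_sub_cos_eq_two_mul_sin_half_sq, one_sub_cos_eq_two_mul_sin_half_sq, abs_le]
  constructor <;>
    nlinarith [sq_nonneg (a * Real.sin (u / 2) - b * Real.sin (v / 2)),
      sq_nonneg (a * Real.sin (u / 2) + b * Real.sin (v / 2))]

lemma abs_integral_fejerKernel_add_sq_mul_cos_sub_cos_le (N k : ℕ) (θ : ℝ) :
    |∫ t in -Real.pi..Real.pi, (fejerKernel N (t - θ) + fejerKernel N (t + θ)) ^ 2 *
      (Real.cos (k * t) - Real.cos (k * θ))| ≤ 8 * Real.pi * N * k ^ 2 := by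
  have hint : ∀ {F : ℝ → ℝ}, Continuous F →
      IntervalIntegrable F volume (-Real.pi) Real.pi := fun h => h.intervalIntegrable _ _
  have hcos : Function.Periodic (fun s : ℝ => Real.cos (k * s)) (2 * Real.pi) := by
    simpa using cos_int_mul_periodic k
  set A := ∫ s in -Real.pi..Real.pi, fejerKernel N s ^ 2 * (1 - Real.cos (k * s)) with hA
  have hA_le : A ≤ 2 * Real.pi * N * k ^ 2 := integral_fejerKernel_sq_mul_one_sub_cos_le N k
  have hA0 : 0 ≤ A := intervalIntegral.integral_nonneg (by linarith [Real.pi_pos])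
    fun s _ => mul_nonneg (sq_nonneg _) (by linarith [Real.cos_le_one (k * s)])
  have hperA : Function.Periodic (fun s => fejerKernel N s ^ 2 * (1 - Real.cos (k * s)))
      (2 * Real.pi) := fun s => by
    have := hcos s
    simp only [fejerKernel_periodic N s] at this ⊢
    rw [this]
  have hA₁ := integral_comp_add_of_periodic_two_pi hperA (-θ)
  have hA₂ := integral_comp_add_of_periodic_two_pi hperA θ
  have hper : ∀ c : ℝ, Function.Periodic (fun s => fejerKernel N s ^ 2 *
      (Real.cos (k * (s + c)) - Real.cos (k * θ))) (2 * Real.pi) := fun c s => by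
    have := hcos (s + c)
    simp only [fejerKernel_periodic N s, add_right_comm s _ c] at this ⊢
    rw [this]
  have hB₁ := integral_comp_add_of_periodic_two_pi (hper θ) (-θ)
  have hB₂ := integral_comp_add_of_periodic_two_pi (hper (-θ)) θ
  simp only [← sub_eq_add_neg, sub_add_cancel, add_sub_cancel_right] at hA₁ hB₁ hB₂
  have hdiag : (∫ s in -Real.pi..Real.pi, fejerKernel N s ^ 2 *
        (Real.cos (k * (s + θ)) - Real.cos (k * θ))) +
      (∫ s in -Real.pi..Real.pi, fejerKernel N s ^ 2 *
        (Real.cos (k * (s - θ)) - Real.cos (k * θ))) = A * (-2 * Real.cos (k * θ)) := by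
    rw [hA, ← intervalIntegral.integral_mul_const, ← intervalIntegral.integral_add
      (hint (by fun_prop)) (hint (by fun_prop))]
    refine intervalIntegral.integral_congr fun s _ => ?_
    simp only [mul_add, mul_sub, Real.cos_add, Real.cos_sub]
    ring
  have hcross : |∫ t in -Real.pi..Real.pi, 2 * fejerKernel N (t - θ) * fejerKernel N (t + θ) *
      (Real.cos (k * t) - Real.cos (k * θ))| ≤ 2 * A := by
    calc _ ≤ ∫ t in -Real.pi..Real.pi, |2 * fejerKernel N (t - θ) * fejerKernel N (t + θ) *
          (Real.cos (k * t) - Real.cos (k * θ))| :=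
          intervalIntegral.abs_integral_le_integral_abs (by linarith [Real.pi_pos])
      _ ≤ ∫ t in -Real.pi..Real.pi, (fejerKernel N (t - θ) ^ 2 * (1 - Real.cos (k * (t - θ))) +
          fejerKernel N (t + θ) ^ 2 * (1 - Real.cos (k * (t + θ)))) := by
          refine intervalIntegral.integral_mono_on (by linarith [Real.pi_pos])
            (hint (by fun_prop)) (hint (by fun_prop)) fun t _ => ?_
          have := abs_two_mul_mul_cos_sub_cos_le (fejerKernel N (t - θ))
            (fejerKernel N (t + θ)) (k * (t - θ)) (k * (t + θ))
          rwa [show ((k : ℝ) * (t - θ) + k * (t + θ)) / 2 = k * t by ring,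
            show ((k : ℝ) * (t + θ) - k * (t - θ)) / 2 = k * θ by ring] at this
      _ = 2 * A := by
          rw [intervalIntegral.integral_add (hint (by fun_prop)) (hint (by fun_prop)), hA₁, hA₂]
          ring
  have hsplit : ∫ t in -Real.pi..Real.pi, (fejerKernel N (t - θ) + fejerKernel N (t + θ)) ^ 2 *
      (Real.cos (k * t) - Real.cos (k * θ)) = A * (-2 * Real.cos (k * θ)) +
      ∫ t in -Real.pi..Real.pi, 2 * fejerKernel N (t - θ) * fejerKernel N (t + θ) *
      (Real.cos (k * t) - Real.cos (k * θ)) := by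
    rw [← hdiag, ← hB₁, ← hB₂, ← intervalIntegral.integral_add
      (hint (by fun_prop)) (hint (by fun_prop)), ← intervalIntegral.integral_add
      (hint (by fun_prop)) (hint (by fun_prop))]
    refine intervalIntegral.integral_congr fun t _ => ?_
    ring
  rw [hsplit]
  have hmain : |A * (-2 * Real.cos (k * θ))| ≤ A * 2 := by
    rw [abs_mul, abs_of_nonneg hA0, abs_mul]
    gcongr
    norm_num
    exact Real.abs_cos_le_one _
  linarith [abs_add_le (A * (-2 * Real.cos (k * θ))) (∫ t in -Real.pi..Real.pi,
    2 * fejerKernel N (t - θ) * fejerKernel N (t + θ) *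
      (Real.cos (k * t) - Real.cos (k * θ)))]

lemma chebMeasure_eq_smul_measureT :
    chebMeasure = ENNReal.ofReal Real.pi⁻¹ • Polynomial.Chebyshev.measureT := by
  rw [chebMeasure, Polynomial.Chebyshev.measureT, restrict_withDensity (by measurability),
    Measure.restrict_congr_set Ioc_ae_eq_Icc.symm, ← withDensity_smul _ (by fun_prop)]
  congr 1
  ext y
  simp only [Pi.smul_apply, smul_eq_mul]
  rw [one_div, mul_inv, ENNReal.ofReal_mul (by positivity), ← Real.sqrt_inv]
  congr 1
  rw [ENNReal.ofReal, Real.toNNReal_of_nonneg (by positivity)]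

lemma integral_chebMeasure {g : ℝ → ℝ} (hg : Continuous g) :
    ∫ y, g y ∂chebMeasure =
      (2 * Real.pi)⁻¹ * ∫ t in -Real.pi..Real.pi, g (Real.cos t) := by
  have hneg : ∫ t in -Real.pi..0, g (Real.cos t) = ∫ t in 0..Real.pi, g (Real.cos t) := by
    simpa using intervalIntegral.integral_comp_neg (a := -Real.pi) (b := 0)
      fun t => g (Real.cos t)
  rw [chebMeasure_eq_smul_measureT, integral_smul_measure,
    Polynomial.Chebyshev.integral_measureT_eq_integral_cos,
    ← intervalIntegral.integral_add_adjacent_intervals (a := -Real.pi) (b := 0)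
      (Continuous.intervalIntegrable (by fun_prop) _ _)
      (Continuous.intervalIntegrable (by fun_prop) _ _), hneg,
    ENNReal.toReal_ofReal (by positivity), smul_eq_mul, mul_inv]
  ring

lemma integrable_chebMeasure {g : ℝ → ℝ} (hg : Continuous g) : Integrable g chebMeasure := by
  rw [chebMeasure_eq_smul_measureT]
  exact (Polynomial.Chebyshev.integrable_measureT hg.continuousOn).smul_measure
    ENNReal.ofReal_ne_top

instance isProbabilityMeasure_chebMeasure : IsProbabilityMeasure chebMeasure := by
  have hfin : IsFiniteMeasure chebMeasure :=
    (integrable_const_iff_isFiniteMeasure one_ne_zero).mp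
      (integrable_chebMeasure (continuous_const (y := (1 : ℝ))))
  have h := integral_chebMeasure (continuous_const (y := (1 : ℝ)))
  rw [integral_const, intervalIntegral.integral_const] at h
  refine ⟨?_⟩
  have hpi := Real.pi_pos
  have h' : chebMeasure.real Set.univ = 1 := by
    simp only [smul_eq_mul, mul_one] at h
    rw [h]
    field_simp
    ring
  rwa [Measure.real, ENNReal.toReal_eq_one_iff] at h'

/-- The polynomial `∑_{i,j<N} T_{i-j}(x) T_{i-j}`, whose value at `cos t` for `x = cos θ` is the
average of the Fejér kernel at `t - θ` and `t + θ`. -/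
noncomputable def fejerPoly (N : ℕ) (x : ℝ) : Polynomial ℝ :=
  ∑ i ∈ Finset.range N, ∑ j ∈ Finset.range N,
    Polynomial.C ((Polynomial.Chebyshev.T ℝ (i - j)).eval x) * Polynomial.Chebyshev.T ℝ (i - j)

lemma natDegree_fejerPoly_le (N : ℕ) (x : ℝ) : (fejerPoly N x).natDegree ≤ N := by
  refine Polynomial.natDegree_sum_le_of_forall_le _ _ fun i hi =>
    Polynomial.natDegree_sum_le_of_forall_le _ _ fun j hj => ?_
  refine (Polynomial.natDegree_C_mul_le _ _).trans ?_
  rw [Polynomial.Chebyshev.natDegree_T]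
  have := Finset.mem_range.mp hi
  have := Finset.mem_range.mp hj
  lia

lemma eval_fejerPoly_cos (N : ℕ) (θ t : ℝ) :
    (fejerPoly N (Real.cos θ)).eval (Real.cos t) =
      (fejerKernel N (t - θ) + fejerKernel N (t + θ)) / 2 := by
  simp only [fejerPoly, fejerKernel, Polynomial.eval_finsetSum, ← Finset.sum_add_distrib,
    Finset.sum_div, Polynomial.eval_mul, Polynomial.eval_C, Polynomial.Chebyshev.T_real_cos]
  refine Finset.sum_congr rfl fun i _ => Finset.sum_congr rfl fun j _ => ?_
  rw [mul_sub, mul_add, Real.cos_sub, Real.cos_add]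
  ring

lemma eval_chebT_cos (k : ℕ) (t : ℝ) : (chebT k).eval (Real.cos t) = Real.cos (k * t) := by
  rw [chebT, Polynomial.Chebyshev.T_real_cos, Int.cast_natCast]

lemma le_integral_fejerPoly_sq {N : ℕ} (hN : 1 ≤ N) {x : ℝ} (hx : x ∈ Set.Icc (-1 : ℝ) 1) :
    (2 * Real.pi)⁻¹ * (2 / 5 * (N : ℝ) ^ 3) ≤ ∫ y, (fejerPoly N x).eval y ^ 2 ∂chebMeasure := by
  rw [integral_chebMeasure (by fun_prop), ← Real.cos_arccos hx.1 hx.2]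
  simp only [eval_fejerPoly_cos, div_pow, intervalIntegral.integral_div]
  have := le_integral_fejerKernel_add_sq hN (Real.arccos x)
  gcongr
  linarith

lemma abs_integral_chebT_sub_mul_fejerPoly_sq_le (N k : ℕ) {x : ℝ}
    (hx : x ∈ Set.Icc (-1 : ℝ) 1) :
    |∫ y, ((chebT k).eval y - (chebT k).eval x) * (fejerPoly N x).eval y ^ 2 ∂chebMeasure| ≤
      N * k ^ 2 := by
  rw [integral_chebMeasure (by fun_prop), ← Real.cos_arccos hx.1 hx.2]
  have h := abs_integral_fejerKernel_add_sq_mul_cos_sub_cos_le N k (Real.arccos x)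
  have e : ∀ t, ((chebT k).eval (Real.cos t) - (chebT k).eval (Real.cos (Real.arccos x))) *
      (fejerPoly N (Real.cos (Real.arccos x))).eval (Real.cos t) ^ 2 =
      ((fejerKernel N (t - Real.arccos x) + fejerKernel N (t + Real.arccos x)) ^ 2 *
      (Real.cos (k * t) - Real.cos (k * Real.arccos x))) / 4 := fun t => by
    rw [eval_fejerPoly_cos, eval_chebT_cos, eval_chebT_cos]
    ring
  simp only [e, intervalIntegral.integral_div]
  rw [abs_mul, abs_div, abs_of_pos (by positivity : 0 < (2 * Real.pi)⁻¹), inv_mul_le_iff₀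
    (by positivity), abs_of_pos (by norm_num : (0 : ℝ) < 4)]
  linarith

lemma exists_polynomial_sq_integral_chebT_near {N : ℕ} (hN : 1 ≤ N) {x : ℝ}
    (hx : x ∈ Set.Icc (-1 : ℝ) 1) :
    ∃ q : Polynomial ℝ, q.natDegree ≤ N ∧ ∫ y, q.eval y ^ 2 ∂chebMeasure = 1 ∧
      ∀ k : ℕ, |∫ y, (chebT k).eval y * q.eval y ^ 2 ∂chebMeasure - (chebT k).eval x| ≤
        9 * Real.exp 1 * k ^ 2 / N ^ 2 := by
  have hN0 : (0 : ℝ) < N := by exact_mod_cast hN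
  set Z := ∫ y, (fejerPoly N x).eval y ^ 2 ∂chebMeasure with hZ
  have hZ_le := le_integral_fejerPoly_sq hN hx
  rw [← hZ] at hZ_le
  have hZ0 : 0 < Z := lt_of_lt_of_le (by positivity) hZ_le
  have hsq : ∀ y, (Polynomial.C (√Z)⁻¹ * fejerPoly N x).eval y ^ 2 =
      (fejerPoly N x).eval y ^ 2 / Z := fun y => by
    rw [Polynomial.eval_mul, Polynomial.eval_C, mul_pow, inv_pow, Real.sq_sqrt hZ0.le]
    field_simp
  refine ⟨Polynomial.C (√Z)⁻¹ * fejerPoly N x,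
    (Polynomial.natDegree_C_mul_le _ _).trans (natDegree_fejerPoly_le N x), ?_, fun k => ?_⟩
  · simp only [hsq, integral_div]
    exact div_self hZ0.ne'
  · have h := abs_integral_chebT_sub_mul_fejerPoly_sq_le N k hx
    simp only [sub_mul] at h
    rw [integral_sub (integrable_chebMeasure (by fun_prop))
      (integrable_chebMeasure (by fun_prop)), integral_const_mul, ← hZ] at h
    simp only [hsq, mul_div_assoc']
    rw [integral_div, div_sub' hZ0.ne', abs_div, abs_of_pos hZ0, mul_comm Z]
    have hconst : (N : ℝ) ^ 3 ≤ 9 * Real.exp 1 * Z := by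
      have h₁ := Real.exp_one_gt_d9
      have h₂ := Real.pi_lt_d2
      have h₃ : 2 / 5 * (N : ℝ) ^ 3 ≤ 2 * Real.pi * Z := by
        rwa [inv_mul_le_iff₀ (by positivity)] at hZ_le
      have h₄ : 2 * Real.pi * Z ≤ 2 * 3.15 * Z := by gcongr
      have h₅ : 9 * 2.7 * Z ≤ 9 * Real.exp 1 * Z := by gcongr; linarith
      linarith
    rw [div_le_div_iff₀ hZ0 (by positivity)]
    calc _ ≤ (N * (k : ℝ) ^ 2) * (N : ℝ) ^ 2 := by gcongr
      _ = (k : ℝ) ^ 2 * (N : ℝ) ^ 3 := by ring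
      _ ≤ (k : ℝ) ^ 2 * (9 * Real.exp 1 * Z) := by gcongr
      _ = _ := by ring

lemma integral_chebT (k : ℕ) (hk : k ≠ 0) : ∫ y, (chebT k).eval y ∂chebMeasure = 0 := by
  rw [chebMeasure_eq_smul_measureT, integral_smul_measure, chebT,
    Polynomial.Chebyshev.integral_eval_T_real_measureT_of_ne_zero (by exact_mod_cast hk), smul_zero]

lemma integral_chebT_mul_chebT_of_ne {j k : ℕ} (h : j ≠ k) :
    ∫ y, (chebT j).eval y * (chebT k).eval y ∂chebMeasure = 0 := by
  rw [chebMeasure_eq_smul_measureT, integral_smul_measure, chebT, chebT,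
    Polynomial.Chebyshev.integral_eval_T_real_mul_eval_T_real_measureT_of_ne h, smul_zero]

lemma integral_chebT_mul_self_ne_zero (k : ℕ) :
    ∫ y, (chebT k).eval y * (chebT k).eval y ∂chebMeasure ≠ 0 := by
  rw [chebMeasure_eq_smul_measureT, integral_smul_measure, chebT,
    ENNReal.toReal_ofReal (by positivity)]
  refine smul_ne_zero (by positivity) ?_
  rcases eq_or_ne k 0 with rfl | hk
  · rw [Nat.cast_zero, Polynomial.Chebyshev.integral_eval_T_real_mul_self_measureT_zero]
    positivity
  · rw [Polynomial.Chebyshev.integral_T_real_mul_self_measureT_of_ne_zero hk]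
    positivity

lemma X_mul_chebT_succ (k : ℕ) :
    Polynomial.X * chebT (k + 1) = Polynomial.C (1 / 2) * (chebT (k + 2) + chebT k) := by
  have h := Polynomial.Chebyshev.T_add_two ℝ k
  simp only [chebT]
  push_cast
  rw [h, sub_add_cancel, ← mul_assoc, ← mul_assoc]
  congr 1
  rw [← Polynomial.C_ofNat, ← Polynomial.C_mul]
  norm_num

lemma integral_pow_mul_chebT_of_lt {m k : ℕ} (h : m < k) :
    ∫ y, y ^ m * (chebT k).eval y ∂chebMeasure = 0 := by
  induction m generalizing k with
  | zero => simpa using integral_chebT k h.ne'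
  | succ m ih =>
    obtain ⟨k, rfl⟩ : ∃ l, k = l + 1 := ⟨k - 1, by lia⟩
    have e : ∀ y : ℝ, y ^ (m + 1) * (chebT (k + 1)).eval y =
        1 / 2 * (y ^ m * (chebT (k + 2)).eval y + y ^ m * (chebT k).eval y) := fun y => by
      have := congrArg (Polynomial.eval y) (X_mul_chebT_succ k)
      simp only [Polynomial.eval_mul, Polynomial.eval_X, Polynomial.eval_C,
        Polynomial.eval_add] at this
      rw [pow_succ, mul_assoc, this]
      ring
    simp only [e]
    rw [integral_const_mul, integral_add (integrable_chebMeasure (by fun_prop))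
      (integrable_chebMeasure (by fun_prop)), ih (by lia), ih (by lia)]
    simp

lemma abs_integral_chebT_mul_sq_le (k : ℕ) (q : Polynomial ℝ) :
    |∫ y, (chebT k).eval y * q.eval y ^ 2 ∂chebMeasure| ≤ ∫ y, q.eval y ^ 2 ∂chebMeasure := by
  refine abs_integral_le_integral_abs.trans ?_
  rw [integral_chebMeasure (by fun_prop), integral_chebMeasure (by fun_prop)]
  gcongr
  refine intervalIntegral.integral_mono_on (by linarith [Real.pi_pos])
    (Continuous.intervalIntegrable (by fun_prop) _ _)
    (Continuous.intervalIntegrable (by fun_prop) _ _) fun t _ => ?_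
  rw [abs_mul, abs_sq, eval_chebT_cos]
  exact mul_le_of_le_one_left (sq_nonneg _) (Real.abs_cos_le_one _)

lemma abs_prod_sub_prod_le_sum_abs_sub {ι : Type*} (s : Finset ι) {a b : ι → ℝ}
    (ha : ∀ i, |a i| ≤ 1) (hb : ∀ i, |b i| ≤ 1) :
    |∏ i ∈ s, a i - ∏ i ∈ s, b i| ≤ ∑ i ∈ s, |a i - b i| := by
  classical
  induction s using Finset.induction_on with
  | empty => simp
  | insert j s hj ih =>
    rw [Finset.prod_insert hj, Finset.prod_insert hj, Finset.sum_insert hj]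
    have hprod : |∏ i ∈ s, b i| ≤ 1 := by
      rw [Finset.abs_prod]
      exact Finset.prod_le_one (fun _ _ => abs_nonneg _) fun i _ => hb i
    calc |a j * ∏ i ∈ s, a i - b j * ∏ i ∈ s, b i|
        = |(a j - b j) * ∏ i ∈ s, b i + a j * (∏ i ∈ s, a i - ∏ i ∈ s, b i)| := by ring_nf
      _ ≤ |a j - b j| * |∏ i ∈ s, b i| + |a j| * |∏ i ∈ s, a i - ∏ i ∈ s, b i| := by
          rw [← abs_mul, ← abs_mul]
          exact abs_add_le _ _
      _ ≤ |a j - b j| * 1 + 1 * ∑ i ∈ s, |a i - b i| := by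
          gcongr
          exact ha j
      _ = _ := by ring

lemma MvPolynomial.eval_aeval_X {ι : Type*} (x : ι → ℝ) (i : ι) (p : Polynomial ℝ) :
    MvPolynomial.eval x (Polynomial.aeval (MvPolynomial.X i) p) = p.eval (x i) := by
  rw [Polynomial.aeval_def, Polynomial.hom_eval₂, MvPolynomial.eval_X, Polynomial.eval,
    MvPolynomial.algebraMap_eq]
  congr 1
  ext a
  simp

lemma MvPolynomial.totalDegree_aeval_X_le {ι : Type*} (i : ι) (p : Polynomial ℝ) :
    (Polynomial.aeval (MvPolynomial.X i : MvPolynomial ι ℝ) p).totalDegree ≤ p.natDegree := by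
  rw [Polynomial.aeval_eq_sum_range]
  refine MvPolynomial.totalDegree_finsetSum_le fun j hj => ?_
  refine (MvPolynomial.totalDegree_smul_le _ _).trans ?_
  rw [MvPolynomial.totalDegree_X_pow]
  exact Finset.mem_range_succ_iff.mp hj

lemma eval_mvChebT {n : ℕ} (α : Fin n → ℕ) (x : Fin n → ℝ) :
    MvPolynomial.eval x (mvChebT n α) = ∏ i, (chebT (α i)).eval (x i) := by
  simp only [mvChebT, map_prod, MvPolynomial.eval_aeval_X]

lemma integral_chebMeasurePi_prod {n : ℕ} (g : Fin n → ℝ → ℝ) :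
    ∫ x, ∏ i, g i (x i) ∂chebMeasurePi n = ∏ i, ∫ y, g i y ∂chebMeasure :=
  integral_fintype_prod_eq_prod g

lemma integrable_chebMeasurePi_prod {n : ℕ} {g : Fin n → ℝ → ℝ} (hg : ∀ i, Continuous (g i)) :
    Integrable (fun x => ∏ i, g i (x i)) (chebMeasurePi n) :=
  Integrable.fintype_prod fun i => integrable_chebMeasure (hg i)

lemma mvChebT_mul_X_mem_span {n : ℕ} (α : Fin n → ℕ) (i : Fin n) :
    mvChebT n α * MvPolynomial.X i ∈ Submodule.span ℝ (Set.range (mvChebT n)) := by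
  have hupd : ∀ m : ℕ, mvChebT n (Function.update α i m) =
      Polynomial.aeval (MvPolynomial.X i) (chebT m) *
        ∏ j ∈ Finset.univ.erase i, Polynomial.aeval (MvPolynomial.X j) (chebT (α j)) := fun m => by
    rw [mvChebT, ← Finset.mul_prod_erase _ _ (Finset.mem_univ i), Function.update_self]
    congr 1
    refine Finset.prod_congr rfl fun j hj => ?_
    rw [Function.update_of_ne (Finset.ne_of_mem_erase hj)]
  have hmem : ∀ m : ℕ, Polynomial.aeval (MvPolynomial.X i) (chebT m) *
        ∏ j ∈ Finset.univ.erase i, Polynomial.aeval (MvPolynomial.X j) (chebT (α j)) ∈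
      Submodule.span ℝ (Set.range (mvChebT n)) := fun m => by
    rw [← hupd]
    exact Submodule.subset_span ⟨_, rfl⟩
  have hα := hupd (α i)
  rw [Function.update_eq_self] at hα
  rw [hα, mul_right_comm, mul_comm _ (MvPolynomial.X i)]
  rcases Nat.eq_zero_or_pos (α i) with h0 | hpos
  · convert hmem 1 using 2
    simp [h0, chebT]
  · obtain ⟨k, hk⟩ : ∃ l, α i = l + 1 := ⟨α i - 1, by lia⟩
    have h := congrArg (Polynomial.aeval (MvPolynomial.X i : MvPolynomial (Fin n) ℝ))
      (X_mul_chebT_succ k)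
    rw [map_mul, Polynomial.aeval_X, ← Polynomial.smul_eq_C_mul, map_smul, map_add] at h
    rw [hk, h, smul_mul_assoc, add_mul]
    exact Submodule.smul_mem _ _ (Submodule.add_mem _ (hmem _) (hmem _))

lemma mem_span_range_mvChebT {n : ℕ} (p : MvPolynomial (Fin n) ℝ) :
    p ∈ Submodule.span ℝ (Set.range (mvChebT n)) := by
  induction p using MvPolynomial.induction_on with
  | C a =>
    have : (MvPolynomial.C a : MvPolynomial (Fin n) ℝ) = a • mvChebT n 0 := by
      simp [mvChebT, chebT, MvPolynomial.smul_eq_C_mul]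
    rw [this]
    exact Submodule.smul_mem _ _ (Submodule.subset_span ⟨_, rfl⟩)
  | add p q hp hq => exact Submodule.add_mem _ hp hq
  | mul_X p i hp =>
    induction hp using Submodule.span_induction with
    | mem _ h => obtain ⟨α, rfl⟩ := h; exact mvChebT_mul_X_mem_span α i
    | zero => simp
    | add p q _ _ hp hq => rw [add_mul]; exact Submodule.add_mem _ hp hq
    | smul a p _ hp => rw [smul_mul_assoc]; exact Submodule.smul_mem _ _ hp

lemma exists_mvChebT_expansion {n : ℕ} (p : MvPolynomial (Fin n) ℝ) :
    ∃ c : (Fin n → ℕ) →₀ ℝ, p = c.sum fun α coef => MvPolynomial.C coef * mvChebT n α := by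
  obtain ⟨c, hc⟩ := Finsupp.mem_span_range_iff_exists_finsupp.mp (mem_span_range_mvChebT p)
  exact ⟨c, by simp only [← hc, MvPolynomial.smul_eq_C_mul]⟩

lemma integral_expansion_mul_prod {n : ℕ} (c : (Fin n → ℕ) →₀ ℝ) {g : Fin n → ℝ → ℝ}
    (hg : ∀ i, Continuous (g i)) :
    ∫ x, MvPolynomial.eval x (c.sum fun α coef => MvPolynomial.C coef * mvChebT n α) *
        ∏ i, g i (x i) ∂chebMeasurePi n =
      ∑ α ∈ c.support, c α * ∏ i, ∫ y, (chebT (α i)).eval y * g i y ∂chebMeasure := by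
  simp only [Finsupp.sum, map_sum, map_mul, MvPolynomial.eval_C, eval_mvChebT, Finset.sum_mul,
    mul_assoc, ← Finset.prod_mul_distrib]
  rw [integral_finsetSum _ fun α _ => Integrable.const_mul
    (integrable_chebMeasurePi_prod (g := fun i y => (chebT (α i)).eval y * g i y)
      fun i => by have := hg i; fun_prop) _]
  refine Finset.sum_congr rfl fun α _ => ?_
  rw [integral_const_mul,
    integral_chebMeasurePi_prod fun i y => (chebT (α i)).eval y * g i y]

lemma integral_mul_mvChebT_of_totalDegree_lt {n : ℕ} {f : MvPolynomial (Fin n) ℝ}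
    {β : Fin n → ℕ} (h : f.totalDegree < ∑ i, β i) :
    ∫ x, MvPolynomial.eval x f * ∏ i, (chebT (β i)).eval (x i) ∂chebMeasurePi n = 0 := by
  simp only [MvPolynomial.eval_eq', Finset.sum_mul, mul_assoc, ← Finset.prod_mul_distrib]
  rw [integral_finsetSum _ fun m _ => Integrable.const_mul
    (integrable_chebMeasurePi_prod (g := fun i y => y ^ m i * (chebT (β i)).eval y)
      fun i => by fun_prop) _]
  refine Finset.sum_eq_zero fun m hm => ?_
  rw [integral_const_mul, integral_chebMeasurePi_prod fun i y => y ^ m i * (chebT (β i)).eval y]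
  have hdeg := MvPolynomial.le_totalDegree hm
  rw [Finsupp.sum_fintype _ _ fun _ => rfl] at hdeg
  obtain ⟨i, -, hi⟩ := Finset.exists_lt_of_sum_lt (hdeg.trans_lt h)
  rw [Finset.prod_eq_zero (Finset.mem_univ i) (integral_pow_mul_chebT_of_lt hi), mul_zero]

lemma sum_le_totalDegree_of_mem_support_expansion {n : ℕ} {c : (Fin n → ℕ) →₀ ℝ}
    {β : Fin n → ℕ} (hβ : β ∈ c.support) :
    ∑ i, β i ≤ (c.sum fun α coef => MvPolynomial.C coef * mvChebT n α).totalDegree := by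
  by_contra! hlt
  have h := integral_mul_mvChebT_of_totalDegree_lt hlt
  rw [integral_expansion_mul_prod c (g := fun i y => (chebT (β i)).eval y)
    fun i => by fun_prop, Finset.sum_eq_single_of_mem β hβ] at h
  · exact mul_ne_zero (Finsupp.mem_support_iff.mp hβ)
      (Finset.prod_ne_zero_iff.mpr fun i _ => integral_chebT_mul_self_ne_zero (β i)) h
  · intro α _ hne
    obtain ⟨i, hi⟩ := Function.ne_iff.mp hne
    rw [Finset.prod_eq_zero (Finset.mem_univ i) (integral_chebT_mul_chebT_of_ne hi), mul_zero]

lemma abs_eval_chebT_le_one (k : ℕ) {x : ℝ} (hx : x ∈ Set.Icc (-1 : ℝ) 1) :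
    |(chebT k).eval x| ≤ 1 := by
  rw [← Real.cos_arccos hx.1 hx.2, eval_chebT_cos]
  exact Real.abs_cos_le_one _

/-- convergence rate for the Lasserre hierarchy of upper bounds
on the hypercube. -/
theorem lasserre_upper_bound_rate (n d : ℕ) (hn : 1 ≤ n) (hd : 1 ≤ d)
    (f : MvPolynomial (Fin n) ℝ) (hdeg : f.totalDegree ≤ d)
    (fmin : ℝ)
    (hfmin : IsLeast {y : ℝ | ∃ x : Fin n → ℝ,
      (∀ i, x i ∈ Set.Icc (-1 : ℝ) 1) ∧ y = MvPolynomial.eval x f} fmin)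
    (r : ℕ) (hr : 3 * (d : ℝ) * Real.sqrt n + 1 ≤ (r : ℝ)) :
    ∃ σ : MvPolynomial (Fin n) ℝ, IsSOS σ ∧ σ.totalDegree ≤ 2 * r * n ∧
      (∫ x, MvPolynomial.eval x σ ∂(chebMeasurePi n)) = 1 ∧
      (∫ x, MvPolynomial.eval x f * MvPolynomial.eval x σ ∂(chebMeasurePi n)) - fmin ≤
        9 * Real.exp 1 * n * (d : ℝ) ^ 2 * mvCheb1Norm f / ((r : ℝ) * ((r : ℝ) - 1)) := by
  obtain ⟨⟨x, hx, rfl⟩, -⟩ := hfmin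
  have hd' : (1 : ℝ) ≤ d := by exact_mod_cast hd
  have hn' : (1 : ℝ) ≤ n := by exact_mod_cast hn
  have hr1 : (1 : ℝ) < r := by
    have := Real.one_le_sqrt.mpr hn'
    nlinarith
  have hr0 : 1 ≤ r := by exact_mod_cast hr1.le
  choose q hqdeg hqint hqnear using fun i => exists_polynomial_sq_integral_chebT_near hr0 (hx i)
  have heval : ∀ y, MvPolynomial.eval y ((∏ i, Polynomial.aeval (MvPolynomial.X i) (q i)) ^ 2) =
      ∏ i, (q i).eval (y i) ^ 2 := fun y => by
    rw [map_pow, map_prod, Finset.prod_pow]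
    simp only [MvPolynomial.eval_aeval_X]
  refine ⟨(∏ i, Polynomial.aeval (MvPolynomial.X i) (q i)) ^ 2, ⟨1, fun _ => _, by simp; rfl⟩,
    ?_, ?_, ?_⟩
  · refine (MvPolynomial.totalDegree_pow _ _).trans ?_
    rw [mul_assoc]
    refine Nat.mul_le_mul_left 2 ((MvPolynomial.totalDegree_finsetProd _ _).trans ?_)
    calc _ ≤ ∑ _i : Fin n, r :=
          Finset.sum_le_sum fun i _ => (MvPolynomial.totalDegree_aeval_X_le i _).trans (hqdeg i)
      _ = r * n := by simp [mul_comm]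
  · simp only [heval]
    rw [integral_chebMeasurePi_prod fun i y => (q i).eval y ^ 2]
    exact Finset.prod_eq_one fun i _ => hqint i
  · simp only [heval]
    set K := 9 * Real.exp 1 * n * (d : ℝ) ^ 2 / ((r : ℝ) * ((r : ℝ) - 1)) with hK
    have hr1' : 0 < (r : ℝ) - 1 := by linarith
    have hK0 : 0 < K := by positivity
    rw [mul_div_right_comm, ← hK, ← div_le_iff₀' hK0]
    refine le_csInf ?_ ?_
    · obtain ⟨c, hc⟩ := exists_mvChebT_expansion f
      exact ⟨_, c, hc, rfl⟩
    rintro _ ⟨c, rfl, rfl⟩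
    rw [div_le_iff₀' hK0, integral_expansion_mul_prod c (g := fun i y => (q i).eval y ^ 2)
      fun i => by fun_prop]
    simp only [Finsupp.sum, map_sum, map_mul, MvPolynomial.eval_C, eval_mvChebT]
    rw [← Finset.sum_sub_distrib, Finset.mul_sum]
    refine Finset.sum_le_sum fun α hα => ?_
    have hαd : ∑ i, α i ≤ d :=
      (sum_le_totalDegree_of_mem_support_expansion hα).trans hdeg
    have hαsq : ∑ i, (α i : ℝ) ^ 2 ≤ (d : ℝ) ^ 2 := by
      calc ∑ i, (α i : ℝ) ^ 2 ≤ (∑ i, (α i : ℝ)) ^ 2 :=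
            Finset.sum_sq_le_sq_sum_of_nonneg fun _ _ => Nat.cast_nonneg _
        _ ≤ _ := by gcongr; exact_mod_cast hαd
    rw [← mul_sub, mul_comm K]
    refine (le_abs_self _).trans ?_
    rw [abs_mul]
    refine mul_le_mul_of_nonneg_left ?_ (abs_nonneg _)
    calc _ ≤ ∑ i, |∫ y, (chebT (α i)).eval y * (q i).eval y ^ 2 ∂chebMeasure -
          (chebT (α i)).eval (x i)| :=
          abs_prod_sub_prod_le_sum_abs_sub _
            (fun i => (abs_integral_chebT_mul_sq_le _ _).trans_eq (hqint i))
            fun i => abs_eval_chebT_le_one _ (hx i)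
      _ ≤ ∑ i, 9 * Real.exp 1 * (α i : ℝ) ^ 2 / (r : ℝ) ^ 2 :=
          Finset.sum_le_sum fun i _ => hqnear i (α i)
      _ = 9 * Real.exp 1 * 1 * (∑ i, (α i : ℝ) ^ 2) / ((r : ℝ) * r) := by
          rw [← Finset.sum_div, ← Finset.mul_sum]
          ring
      _ ≤ K := by
          rw [hK]
          gcongr
          linarith
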